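/- Let X be a reduced commutative ring A with an injective ring map A → B which is finite étale. Then B is reduced. -/

import Mathlib

universe u

open TensorProduct in
/-- If `A` is a reduced commutative ring and `A → B` is an injective finite étale ring
map, then `B` is reduced. -/
theorem stmt_17 (A B : Type u) [CommRing A] [CommRing B] [Algebra A B]
    [IsReduced A] [Algebra.Etale A B] [Module.Finite A B]
    (hinj : Function.Injective (algebraMap A B)) :
    IsReduced B := by
  have : Module.Flat A B := inferInstance
  have : Module.FinitePresentation A B :=
    (Module.FinitePresentation.iff_finitePresentation_of_finite A B).mpr inferInstance
  have : Module.Projective A B := Module.Flat.projective_of_finitePresentation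
  refine ⟨fun x hx => ?_⟩
  rw [← Module.forall_dual_apply_eq_zero_iff A x]
  intro f
  apply IsReduced.eq_zero
  rw [← mem_nilradical, nilradical_eq_sInf, Ideal.mem_sInf]
  intro p hp
  have hp : p.IsPrime := hp
  have : IsReduced (p.ResidueField ⊗[A] B) :=
    Algebra.FormallyUnramified.isReduced_of_field p.ResidueField _
  have h1 : (1 : p.ResidueField) ⊗ₜ[A] x = 0 :=
    (hx.map (Algebra.TensorProduct.includeRight : B →ₐ[A] p.ResidueField ⊗[A] B)).eq_zero
  have h2 := congrArg (fun z => TensorProduct.rid A _ (f.lTensor p.ResidueField z)) h1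
  simpa [Algebra.smul_def] using h2
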